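/- arXiv:0711.4052 — 2 statements merged into one kernel-verified Lean document; each statement's English description precedes it below -/
import Mathlib

section
/- Let D be a finite digraph without useless arcs for r ∈ V(D), and let T be a 1-optimal out-branching of D rooted at r. If there exists a leaf l of T and a vertex z with z ≺_T l such that |HB_D^T(z,l)| ≥ 6k², then D has an out-branching with at least k leaves. -/
/-- A (finite) digraph: a finite vertex set together with a finite set of arcs. -/
structure Dgraph (V : Type*) where
  verts : Finset V
  arcs : Finset (V × V)

variable {V : Type*} [DecidableEq V]

/-- All arcs have both endpoints among the vertices. -/
def DgraphWF (D : Dgraph V) : Prop := ∀ a ∈ D.arcs, a.1 ∈ D.verts ∧ a.2 ∈ D.verts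

/-- `v` is reachable from `u` by a dipath in `D`. -/
def Dgraph.Reaches (D : Dgraph V) (u v : V) : Prop :=
  Relation.ReflTransGen (fun a b => (a, b) ∈ D.arcs) u v

def inDeg (D : Dgraph V) (v : V) : ℕ := (D.arcs.filter (fun a => a.2 = v)).card

def outDeg (D : Dgraph V) (v : V) : ℕ := (D.arcs.filter (fun a => a.1 = v)).card

/-- `T` is an out-tree with root `r`: exactly one vertex (the root) of in-degree 0,
all other vertices of in-degree 1, and (equivalently to being connected and acyclic
as an undirected graph) every vertex is reachable from the root. -/
def IsOutTree (T : Dgraph V) (r : V) : Prop :=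
  (∀ a ∈ T.arcs, a.1 ∈ T.verts ∧ a.2 ∈ T.verts) ∧
  r ∈ T.verts ∧ inDeg T r = 0 ∧
  (∀ v ∈ T.verts, v ≠ r → inDeg T v = 1) ∧
  (∀ v ∈ T.verts, T.Reaches r v)

def IsSubgraph (T D : Dgraph V) : Prop := T.verts ⊆ D.verts ∧ T.arcs ⊆ D.arcs

/-- `T` is an out-branching (a spanning out-tree) of `D` with root `r`. -/
def IsOutBranching (D T : Dgraph V) (r : V) : Prop :=
  IsSubgraph T D ∧ T.verts = D.verts ∧ IsOutTree T r

/-- The set of leaves (vertices of out-degree 0). -/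
def leaves (T : Dgraph V) : Finset V := T.verts.filter (fun v => outDeg T v = 0)

/-- Vertices whose in-neighbor is a branch vertex (a vertex of out-degree at least 2). -/
def brSucc (T : Dgraph V) : Finset V :=
  T.verts.filter (fun v => ∃ a ∈ T.arcs, a.2 = v ∧ 2 ≤ outDeg T a.1)

/-- The 1-change for arc `(u,v)`, where `w` is the in-neighbor of `v` in `T`:
`T + (u,v) - (w,v)`. -/
def oneChange (T : Dgraph V) (u v w : V) : Dgraph V :=
  ⟨T.verts, insert (u, v) (T.arcs.erase (w, v))⟩

/-- `T` is a 1-optimal out-branching of `D` rooted at `r`: no 1-change for an arc of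
`A(D) \ A(T)` results in an out-branching with more leaves. -/
def OneOptimal (D T : Dgraph V) (r : V) : Prop :=
  ∀ u v w, (u, v) ∈ D.arcs → (u, v) ∉ T.arcs → v ≠ r → (w, v) ∈ T.arcs →
    ∀ r', IsOutBranching D (oneChange T u v w) r' →
      (leaves (oneChange T u v w)).card ≤ (leaves T).card

/-- The list of vertices `p` forms a dipath in `D`. -/
def IsDipath (D : Dgraph V) (p : List V) : Prop :=
  p.Nodup ∧ (∀ x ∈ p, x ∈ D.verts) ∧ p.Chain' (fun a b => (a, b) ∈ D.arcs)

/-- Delete a vertex and all incident arcs. -/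
def delVert (D : Dgraph V) (v : V) : Dgraph V :=
  ⟨D.verts.erase v, D.arcs.filter (fun a => a.1 ≠ v ∧ a.2 ≠ v)⟩

open Classical in
/-- `HB_D^T(z,l)`: the heads of arcs `(u,v)` of `D` with `v ≺_T z ⪯_T u ⪯_T l`,
minus `BrSucc(T)`. -/
noncomputable def HBset (D T : Dgraph V) (z l : V) : Finset V :=
  ((D.arcs.filter (fun a =>
      (T.Reaches a.2 z ∧ a.2 ≠ z) ∧ T.Reaches z a.1 ∧ T.Reaches a.1 l)).image Prod.snd)
    \ brSucc T

/-- The consecutive pairs of a list, cyclically (with wraparound). -/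
def cycPairs (c : List V) : List (V × V) := c.zip (c.rotate 1)

open Relation

/-- Walks of the relation `E` from `a` to `b` on which no vertex after `a` belongs to `X`. -/
def AvoidReach {α : Type*} (E : α → α → Prop) (X : Set α) : α → α → Prop :=
  ReflTransGen fun a b => E a b ∧ b ∉ X

namespace AvoidReach

variable {α : Type*} {E F : α → α → Prop} {X Y : Set α} {a b c : α}

theorem anti (h : AvoidReach E X a b) (hYX : Y ⊆ X) : AvoidReach E Y a b :=
  ReflTransGen.mono (fun _ _ h => ⟨h.1, fun hb => h.2 (hYX hb)⟩) _ _ h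

theorem trans (h : AvoidReach E X a b) (h' : AvoidReach E X b c) : AvoidReach E X a c :=
  ReflTransGen.trans h h'

theorem tail (h : AvoidReach E X a b) (h' : E b c) (hc : c ∉ X) : AvoidReach E X a c :=
  ReflTransGen.tail h ⟨h', hc⟩

/-- A walk in a subrelation `F` avoids `X` if no vertex other than its start that lies between its
ends with respect to `F` belongs to `X`. -/
theorem of_reflTransGen (hFE : ∀ x y, F x y → E x y) (h : ReflTransGen F a b)
    (hX : ∀ x, ReflTransGen F a x → ReflTransGen F x b → x ∈ X → x = a) (ha : a ∉ X) :
    AvoidReach E X a b := by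
  induction h with
  | refl => exact ReflTransGen.refl
  | @tail y y' hy hyy' ih =>
    refine (ih fun x h1 h2 => hX x h1 (h2.tail hyy')).tail (hFE _ _ hyy') fun hmem => ?_
    have := hX y' (hy.tail hyy') .refl hmem
    exact ha (this ▸ hmem)

/-- A walk which cannot avoid `c` passes through `c`. -/
theorem through (h : AvoidReach E X a b) (hn : ¬ AvoidReach E {c} a b) :
    AvoidReach E X a c := by
  induction h with
  | refl => exact absurd ReflTransGen.refl hn
  | @tail y y' hy hyy' ih =>
    by_cases hc : AvoidReach E {c} a y
    · by_cases hyc : y' = c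
      · subst hyc; exact ReflTransGen.tail hy hyy'
      · exact absurd (hc.tail hyy'.1 hyc) hn
    · exact ih hc

/-- The last step with which an `X`-avoiding walk enters a set `A`. -/
theorem last_entry (h : AvoidReach E X a b) {A : Set α} (ha : a ∉ A) (hb : b ∈ A) :
    ∃ x y, E x y ∧ x ∉ A ∧ y ∈ A ∧ y ∉ X ∧ AvoidReach E (Aᶜ ∪ X) y b := by
  induction h with
  | refl => exact absurd hb ha
  | @tail y y' _ hyy' ih =>
    by_cases hy : y ∈ A
    · obtain ⟨x, w, h1, h2, h3, h4, h5⟩ := ih hy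
      exact ⟨x, w, h1, h2, h3, h4, h5.tail hyy'.1 (by simp [hb, hyy'.2])⟩
    · exact ⟨y, y', hyy'.1, hy, hb, hyy'.2, ReflTransGen.refl⟩

end AvoidReach

theorem exists_path_of_reflTransGen {α : Type*} {E : α → α → Prop} {a b : α}
    (h : ReflTransGen E a b) :
    ∃ (n : ℕ) (p : ℕ → α), p 0 = a ∧ p n = b ∧ ∀ i < n, E (p i) (p (i + 1)) := by
  induction h with
  | refl => exact ⟨0, fun _ => a, rfl, rfl, by simp⟩
  | @tail y y' _ hyy' ih =>
    obtain ⟨n, p, h0, hn, hp⟩ := ih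
    refine ⟨n + 1, fun i => if i ≤ n then p i else y', by simp [h0], by simp, fun i hi => ?_⟩
    rcases Nat.lt_succ_iff_lt_or_eq.mp hi with h | rfl
    · simpa [h.le, Nat.succ_le_of_lt h] using hp i h
    · simpa [hn] using hyy'

theorem reflTransGen_of_path {α : Type*} {E : α → α → Prop} {n : ℕ} {p : ℕ → α}
    (hp : ∀ i < n, E (p i) (p (i + 1))) {i j : ℕ} (hij : i ≤ j) (hj : j ≤ n) :
    ReflTransGen E (p i) (p j) := by
  induction j, hij using Nat.le_induction with
  | base => exact .refl
  | succ j _ ih => exact (ih (by omega)).tail (hp j (by omega))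

section TwoPaths

variable {α : Type*} {E : α → α → Prop} {n : ℕ} {p : ℕ → α} {S : Set α}

/-- There is a walk from `p i` to `p j` none of whose internal vertices lies in `S`. -/
def FreeJump (E : α → α → Prop) (S : Set α) (p : ℕ → α) (i j : ℕ) : Prop :=
  ∃ y, AvoidReach E S (p i) y ∧ E y (p j)

theorem exists_freeJump_over (hp : ∀ i < n, E (p i) (p (i + 1)))
    (hinj : ∀ i ≤ n, ∀ j ≤ n, p i = p j → i = j)
    (hS : ∀ s ∈ S, ∃ i, 0 < i ∧ i < n ∧ p i = s)
    (hav : ∀ s ∈ S, AvoidReach E {s} (p 0) (p n)) {c : ℕ} (hc0 : 0 < c) (hcn : c < n) :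
    ∃ a b, a < c ∧ c < b ∧ b ≤ n ∧ FreeJump E S p a b := by
  by_cases hcS : p c ∈ S
  · have key : ∀ y, AvoidReach E {p c} (p 0) y →
        (∃ a b, a < c ∧ c < b ∧ b ≤ n ∧ FreeJump E S p a b) ∨
        y ≠ p n ∧ ∃ a < c, AvoidReach E S (p a) y := by
      intro y hy
      induction hy with
      | refl => exact .inr ⟨fun h => by have := hinj _ (by omega) _ le_rfl h; omega, 0, hc0, .refl⟩
      | @tail y y' _ hyy' ih =>
        rcases ih with h | ⟨-, a, ha, hay⟩
        · exact .inl h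
        by_cases hy'n : y' = p n
        · subst hy'n
          exact .inl ⟨a, n, ha, hcn, le_rfl, y, hay, hyy'.1⟩
        by_cases hy'S : y' ∈ S
        · obtain ⟨j, -, hjn, rfl⟩ := hS _ hy'S
          rcases lt_trichotomy j c with hj | rfl | hj
          · exact .inr ⟨hy'n, j, hj, .refl⟩
          · exact absurd rfl hyy'.2
          · exact .inl ⟨a, j, ha, hj, hjn.le, y, hay, hyy'.1⟩
        · exact .inr ⟨hy'n, a, ha, hay.tail hyy'.1 hy'S⟩
    exact (key _ (hav _ hcS)).resolve_right fun h => h.1 rfl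
  · refine ⟨c - 1, c + 1, by omega, by omega, by omega, p c, ?_, hp c hcn⟩
    have := hp (c - 1) (by omega)
    rw [Nat.sub_add_cancel hc0] at this
    exact ReflTransGen.single ⟨this, hcS⟩

theorem AvoidReach.along_path (hp : ∀ i < n, E (p i) (p (i + 1))) {X : Set α} {x : α} {c j : ℕ}
    (h : AvoidReach E X x (p c)) (hcj : c ≤ j) (hj : j ≤ n)
    (hX : ∀ i, c < i → i ≤ j → p i ∉ X) : AvoidReach E X x (p j) := by
  induction j, hcj using Nat.le_induction with
  | base => exact h
  | succ j hcj ih =>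
    exact (ih (by omega) fun i h1 h2 => hX i h1 (by omega)).tail (hp j (by omega))
      (hX _ (by omega) le_rfl)

open Classical in
theorem exists_two_walks_aux (hp : ∀ i < n, E (p i) (p (i + 1)))
    (hinj : ∀ i ≤ n, ∀ j ≤ n, p i = p j → i = j)
    (hS : ∀ s ∈ S, ∃ i, 0 < i ∧ i < n ∧ p i = s)
    (hav : ∀ s ∈ S, AvoidReach E {s} (p 0) (p n)) (d b c : ℕ) (A B : Set α)
    (hd : n - b = d) (hcb : c < b) (hbn : b ≤ n)
    (hA : AvoidReach E A (p 0) (p b)) (hB : AvoidReach E B (p 0) (p c))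
    (hAS : A ⊆ S) (hBS : B ⊆ S) (hAB : S ⊆ A ∪ B)
    (hA' : ∀ i, c ≤ i → i ≤ n → i ≠ b → p i ∈ S → p i ∈ A)
    (hB' : ∀ i, c < i → i ≤ n → p i ∈ S → p i ∈ B)
    (hmax : ∀ a < c, ∀ j ≤ n, FreeJump E S p a j → j ≤ b) :
    ∃ A B : Set α, A ⊆ S ∧ B ⊆ S ∧ S ⊆ A ∪ B ∧
      AvoidReach E A (p 0) (p n) ∧ AvoidReach E B (p 0) (p n) := by
  induction d using Nat.strong_induction_on generalizing b c A B with
  | _ d ih =>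
  rcases hbn.eq_or_lt with rfl | hlt
  · refine ⟨A, B \ {x | ∃ i, c < i ∧ i ≤ b ∧ p i = x}, hAS, Set.sdiff_subset.trans hBS, ?_, hA,
      (hB.anti Set.sdiff_subset).along_path hp hcb.le le_rfl fun i h1 h2 h3 => h3.2 ⟨i, h1, h2, rfl⟩⟩
    intro x hx
    by_cases hxi : ∃ i, c < i ∧ i ≤ b ∧ p i = x
    · obtain ⟨i, h1, h2, rfl⟩ := hxi
      refine .inl (hA' i h1.le h2 ?_ hx)
      rintro rfl
      obtain ⟨j, -, hj, hji⟩ := hS _ hx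
      have := hinj _ hj.le _ le_rfl hji
      omega
    · exact (hAB hx).imp id fun h => ⟨h, hxi⟩
  · let P : ℕ → Prop := fun j => ∃ a < b, FreeJump E S p a j
    obtain ⟨a, b', hab, hbb', hb'n, hj⟩ := exists_freeJump_over hp hinj hS hav (by omega) hlt
    have hP : P b' := ⟨a, hab, hj⟩
    set β := Nat.findGreatest P n with hβ
    have hβP : P β := Nat.findGreatest_spec hb'n hP
    have hβb : b < β := hbb'.trans_le (Nat.le_findGreatest hb'n hP)
    have hβn : β ≤ n := Nat.findGreatest_le n
    obtain ⟨α', hαb, y, hαy, hyβ⟩ := hβP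
    have hcα : c ≤ α' := by
      by_contra h
      have := hmax α' (by omega) β hβn ⟨y, hαy, hyβ⟩
      omega
    let R : Set α := {x | ∃ i, c < i ∧ i ≤ n ∧ (i ≤ α' ∨ i = β) ∧ p i = x}
    refine ih (n - β) (by omega) β b (B \ R) A rfl hβb hβn ?_ hA (Set.sdiff_subset.trans hBS)
      hAS ?_ ?_ ?_ ?_
    · have h1 : AvoidReach E (B \ R) (p 0) (p α') :=
        (hB.anti Set.sdiff_subset).along_path hp hcα (by omega) fun i h1 h2 h3 =>
          h3.2 ⟨i, h1, by omega, .inl h2, rfl⟩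
      exact (h1.trans (hαy.anti (Set.sdiff_subset.trans hBS))).tail hyβ fun h =>
        h.2 ⟨β, by omega, hβn, .inr rfl, rfl⟩
    · intro x hx
      by_cases hxR : x ∈ R
      · obtain ⟨i, h1, h2, h3, rfl⟩ := hxR
        exact .inr (hA' i h1.le h2 (by omega) hx)
      · rcases hAB hx with h | h
        · exact .inr h
        · exact .inl ⟨h, hxR⟩
    · intro i h1 h2 h3 h4
      refine ⟨hB' i (by omega) h2 h4, ?_⟩
      rintro ⟨j, h5, h6, h7, h8⟩
      have := hinj _ h6 _ h2 h8
      omega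
    · intro i h1 h2 h4
      exact hA' i (by omega) h2 (by omega) h4
    · intro a ha j hj hfj
      exact Nat.le_findGreatest hj ⟨a, ha, hfj⟩

/-- If no vertex of `S`, a set of internal vertices of the path `p`, separates the ends of `p`,
then these ends are joined by two walks which have no vertex of `S` in common. -/
theorem exists_two_walks (hp : ∀ i < n, E (p i) (p (i + 1)))
    (hinj : ∀ i ≤ n, ∀ j ≤ n, p i = p j → i = j)
    (hS : ∀ s ∈ S, ∃ i, 0 < i ∧ i < n ∧ p i = s)
    (hav : ∀ s ∈ S, AvoidReach E {s} (p 0) (p n)) :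
    ∃ A B : Set α, A ⊆ S ∧ B ⊆ S ∧ S ⊆ A ∪ B ∧
      AvoidReach E A (p 0) (p n) ∧ AvoidReach E B (p 0) (p n) := by
  rcases Nat.eq_zero_or_pos n with rfl | hn
  · exact ⟨S, S, subset_rfl, subset_rfl, by simp, .refl, .refl⟩
  refine exists_two_walks_aux hp hinj hS hav _ 1 0 (S \ {p 1}) S rfl one_pos hn
    (ReflTransGen.single ⟨hp 0 hn, by simp⟩) .refl Set.sdiff_subset subset_rfl (by simp) ?_
    (fun _ _ _ h => h) (by simp)
  intro i _ hi h1 hiS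
  exact ⟨hiS, fun h => h1 (hinj _ hi _ hn h)⟩

open Classical in
/-- If no vertex of `S`, a set of internal vertices of the path `p`, separates the ends of `p`,
then these ends are joined by a walk avoiding at least half of `S`. -/
theorem exists_walk_avoiding_half (S : Finset α) (hp : ∀ i < n, E (p i) (p (i + 1)))
    (hinj : ∀ i ≤ n, ∀ j ≤ n, p i = p j → i = j)
    (hS : ∀ s ∈ S, ∃ i, 0 < i ∧ i < n ∧ p i = s)
    (hav : ∀ s ∈ S, AvoidReach E {s} (p 0) (p n)) :
    ∃ W ⊆ S, S.card ≤ 2 * W.card ∧ AvoidReach E (W : Set α) (p 0) (p n) := by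
  obtain ⟨A, B, hAS, hBS, hAB, hA, hB⟩ :=
    exists_two_walks (S := (S : Set α)) hp hinj (by simpa using hS) (by simpa using hav)
  have hcov : S ⊆ S.filter (· ∈ A) ∪ S.filter (· ∈ B) := by
    intro x hx
    have : x ∈ A ∨ x ∈ B := hAB hx
    simp only [Finset.mem_union, Finset.mem_filter]
    tauto
  have h1 := (Finset.card_le_card hcov).trans (Finset.card_union_le _ _)
  by_cases h : (S.filter (· ∈ B)).card ≤ (S.filter (· ∈ A)).card
  · exact ⟨S.filter (· ∈ A), Finset.filter_subset _ _, by omega, hA.anti fun x hx =>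
      (Finset.mem_filter.mp hx).2⟩
  · exact ⟨S.filter (· ∈ B), Finset.filter_subset _ _, by omega, hB.anti fun x hx =>
      (Finset.mem_filter.mp hx).2⟩

end TwoPaths

open Classical in
/-- A family of intervals of which fewer than `c` share a point and which has at least `m * c`
members contains `m` pairwise disjoint ones. -/
theorem exists_disjoint_intervals {α : Type*} (τ e : α → ℕ) (c m : ℕ) (H : Finset α)
    (hle : ∀ v ∈ H, τ v ≤ e v)
    (hpt : ∀ x, (H.filter fun v => τ v ≤ x ∧ x ≤ e v).card ≤ c) (hcard : m * c ≤ H.card)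
    (hne : 0 < c) :
    ∃ I ⊆ H, m ≤ I.card ∧ ∀ i ∈ I, ∀ j ∈ I, i ≠ j → e i < τ j ∨ e j < τ i := by
  induction m generalizing H with
  | zero => exact ⟨∅, by simp, by simp, by simp⟩
  | succ m ih =>
    rw [Nat.succ_mul] at hcard
    obtain ⟨v, hv, hmin⟩ := H.exists_min_image e (Finset.card_pos.mp (by omega))
    set H' := H.filter fun w => ¬ (τ w ≤ e v ∧ e v ≤ e w) with hH'
    have hsplit := Finset.card_filter_add_card_filter_not (s := H)
      (fun w => τ w ≤ e v ∧ e v ≤ e w)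
    have hc := hpt (e v)
    have hH'c : m * c ≤ H'.card := by rw [hH']; omega
    obtain ⟨I, hI, hIm, hdis⟩ := ih H' (fun w hw => hle w (Finset.filter_subset _ _ hw))
      (fun x => (Finset.card_le_card (Finset.filter_subset_filter _
        (Finset.filter_subset _ _))).trans (hpt x)) hH'c
    have hlt : ∀ w ∈ I, e v < τ w := by
      intro w hw
      have := hI hw
      simp only [hH', Finset.mem_filter] at this
      have := hmin w this.1
      grind
    have hvI : v ∉ I := fun h => by have := hlt v h; have := hle v hv; omega
    refine ⟨insert v I, ?_, ?_, ?_⟩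
    · exact Finset.insert_subset hv (hI.trans (Finset.filter_subset _ _))
    · rw [Finset.card_insert_of_notMem hvI]; omega
    · intro i hi j hj hij
      rcases Finset.mem_insert.mp hi with rfl | hi' <;>
        rcases Finset.mem_insert.mp hj with rfl | hj'
      · exact absurd rfl hij
      · exact .inl (hlt _ hj')
      · exact .inr (hlt _ hi')
      · exact hdis i hi' j hj' hij

section OutTree

variable {D T : Dgraph V} {r : V}

namespace IsOutTree

theorem parent_unique (hT : IsOutTree T r) {w w' v : V} (h : (w, v) ∈ T.arcs)
    (h' : (w', v) ∈ T.arcs) : w = w' := by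
  obtain ⟨h1, -, h3, h4, -⟩ := hT
  have hle : inDeg T v ≤ 1 := by
    by_cases hv : v = r
    · rw [hv, h3]; exact zero_le_one
    · exact (h4 v (h1 _ h).2 hv).le
  have := Finset.card_le_one.mp hle (w, v) (by simp [h]) (w', v) (by simp [h'])
  exact (Prod.mk.inj this).1

theorem not_arc_root (hT : IsOutTree T r) (w : V) : (w, r) ∉ T.arcs := by
  intro h
  have := Finset.card_eq_zero.mp hT.2.2.1
  have hm : (w, r) ∈ T.arcs.filter (fun a => a.2 = r) := by simp [h]
  simp [this] at hm

theorem not_transGen (hT : IsOutTree T r) {v : V} (hv : v ∈ T.verts) :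
    ¬ TransGen (fun a b => (a, b) ∈ T.arcs) v v := by
  have h : ReflTransGen (fun a b => (a, b) ∈ T.arcs) r v := hT.2.2.2.2 v hv
  induction h with
  | refl =>
    intro h
    obtain ⟨w, -, hw⟩ := TransGen.tail'_iff.mp h
    exact hT.not_arc_root w hw
  | @tail a b _ hab ih =>
    intro h
    obtain ⟨c, hbc, hcb⟩ := TransGen.tail'_iff.mp h
    obtain rfl := hT.parent_unique hab hcb
    exact ih (hT.1 _ hab).1 (TransGen.head' hab hbc)

theorem mem_verts_of_reaches (hT : IsOutTree T r) {a b : V} (h : T.Reaches a b)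
    (ha : a ∈ T.verts) : b ∈ T.verts := by
  rcases ReflTransGen.cases_tail h with rfl | ⟨c, -, hc⟩
  · exact ha
  · exact (hT.1 _ hc).2

theorem reaches_antisymm (hT : IsOutTree T r) {a b : V} (h : T.Reaches a b)
    (h' : T.Reaches b a) : a = b := by
  rcases ReflTransGen.cases_tail h with rfl | ⟨c, hac, hcb⟩
  · rfl
  · exact absurd ((TransGen.tail' hac hcb).trans_left h')
      (hT.not_transGen (hT.mem_verts_of_reaches h' (hT.1 _ hcb).2))

theorem reaches_parent (hT : IsOutTree T r) {v w b : V} (h : T.Reaches v b) (hb : b ≠ v)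
    (hw : (w, b) ∈ T.arcs) : T.Reaches v w := by
  rcases ReflTransGen.cases_tail h with rfl | ⟨c, hvc, hcb⟩
  · exact absurd rfl hb
  · rwa [← hT.parent_unique hcb hw]

theorem eq_root_of_reaches (hT : IsOutTree T r) {v : V} (h : T.Reaches v r) : v = r := by
  rcases ReflTransGen.cases_tail h with rfl | ⟨c, -, hc⟩
  · rfl
  · exact absurd hc (hT.not_arc_root c)

/-- Walks of an out-tree only meet descendants of their start and ancestors of their end. -/
theorem avoidReach (hTD : IsSubgraph T D) {X : Set V} {a b : V} (h : T.Reaches a b)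
    (hX : ∀ x ∈ X, T.Reaches a x → T.Reaches x b → x = a) (ha : a ∉ X) :
    AvoidReach (fun a b => (a, b) ∈ D.arcs) X a b :=
  AvoidReach.of_reflTransGen (fun _ _ h => hTD.2 h) h (fun x h1 h2 hx => hX x hx h1 h2) ha

theorem path_injective (hT : IsOutTree T r) {n : ℕ} {p : ℕ → V}
    (hp : ∀ i < n, (p i, p (i + 1)) ∈ T.arcs) :
    ∀ i ≤ n, ∀ j ≤ n, p i = p j → i = j := by
  have key : ∀ i j, i < j → j ≤ n → p i ≠ p j := by
    intro i j hij hj h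
    obtain ⟨k, rfl⟩ : ∃ k, j = k + 1 := ⟨j - 1, by omega⟩
    have h1 := reflTransGen_of_path (E := fun a b => (a, b) ∈ T.arcs) hp
      (Nat.le_of_lt_succ hij) (by omega)
    have h2 := hp k (by omega)
    rw [← h] at h2
    exact hT.not_transGen (hT.1 _ h2).2 (TransGen.tail' h1 h2)
  intro i hi j hj h
  rcases lt_trichotomy i j with hij | hij | hij
  · exact absurd h (key i j hij hj)
  · exact hij
  · exact absurd h.symm (key j i hij hi)

theorem mem_path (hT : IsOutTree T r) {n : ℕ} {p : ℕ → V}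
    (hp : ∀ i < n, (p i, p (i + 1)) ∈ T.arcs) {s : V} (hs₀ : T.Reaches (p 0) s)
    (hs : T.Reaches s (p n)) : ∃ i ≤ n, p i = s := by
  induction n with
  | zero => exact ⟨0, le_rfl, hT.reaches_antisymm hs₀ hs⟩
  | succ n ih =>
    by_cases h : p (n + 1) = s
    · exact ⟨n + 1, le_rfl, h⟩
    · obtain ⟨i, hi, rfl⟩ := ih (fun i hi => hp i (by omega))
        (hT.reaches_parent hs h (hp n (by omega)))
      exact ⟨i, by omega, rfl⟩

theorem card_arcs (hT : IsOutTree T r) : T.arcs.card + 1 = T.verts.card := by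
  have h := Finset.card_eq_sum_card_fiberwise (f := Prod.snd) (s := T.arcs) (t := T.verts)
    fun a ha => (hT.1 a ha).2
  have h2 : ∀ v ∈ T.verts.erase r, (T.arcs.filter fun a => a.2 = v).card = 1 := fun v hv =>
    hT.2.2.2.1 v (Finset.mem_of_mem_erase hv) (Finset.ne_of_mem_erase hv)
  rw [← Finset.add_sum_erase _ _ hT.2.1, Finset.sum_congr rfl h2] at h
  have h3 : (T.arcs.filter fun a => a.2 = r).card = 0 := hT.2.2.1
  rw [h, h3, Finset.sum_const, smul_eq_mul, mul_one, zero_add,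
    Finset.card_erase_add_one hT.2.1]

theorem card_brSucc_add_two_le (hT : IsOutTree T r) :
    (brSucc T).card + 2 ≤ 2 * (leaves T).card := by
  have harcs := hT.card_arcs
  have h := Finset.card_eq_sum_card_fiberwise (f := Prod.fst) (s := T.arcs) (t := T.verts)
    fun a ha => (hT.1 a ha).1
  have hbr : (brSucc T).card ≤ ∑ v ∈ T.verts, if 2 ≤ outDeg T v then outDeg T v else 0 := by
    rw [← Finset.sum_filter]
    refine le_trans (Finset.card_le_card (t := (T.verts.filter fun v => 2 ≤ outDeg T v).biUnion
      fun v => (T.arcs.filter fun a => a.1 = v).image Prod.snd) ?_) (Finset.card_biUnion_le.trans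
        (Finset.sum_le_sum fun v _ => Finset.card_image_le))
    intro v hv
    obtain ⟨-, a, ha, rfl, h2⟩ := Finset.mem_filter.mp hv
    simp only [Finset.mem_biUnion, Finset.mem_filter, Finset.mem_image]
    exact ⟨a.1, ⟨(hT.1 a ha).1, h2⟩, a, ⟨ha, rfl⟩, rfl⟩
  have hle : (leaves T).card = ∑ v ∈ T.verts, if outDeg T v = 0 then 1 else 0 := by
    simp [leaves]
  have hsum : ∑ v ∈ T.verts, ((if 2 ≤ outDeg T v then outDeg T v else 0) + 2) ≤
      ∑ v ∈ T.verts, (2 * outDeg T v + 2 * if outDeg T v = 0 then 1 else 0) := by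
    refine Finset.sum_le_sum fun v _ => ?_
    split_ifs <;> omega
  rw [Finset.sum_add_distrib, Finset.sum_add_distrib, ← Finset.mul_sum, ← Finset.mul_sum, ← hle,
    Finset.sum_const, smul_eq_mul] at hsum
  have h' : T.arcs.card = ∑ v ∈ T.verts, outDeg T v := h
  omega

theorem insert_arc (hT : IsOutTree T r) {a b : V} (ha : a ∈ T.verts) (hb : b ∉ T.verts) :
    IsOutTree ⟨insert b T.verts, insert (a, b) T.arcs⟩ r := by
  have hbr : b ≠ r := fun h => hb (h ▸ hT.2.1)
  have hin : ∀ v, v ≠ b → inDeg ⟨insert b T.verts, insert (a, b) T.arcs⟩ v = inDeg T v := by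
    intro v hv
    simp [inDeg, Finset.filter_insert, hv.symm]
  refine ⟨?_, by simp [hT.2.1], ?_, ?_, ?_⟩
  · intro x hx
    rcases Finset.mem_insert.mp hx with rfl | hx
    · simp [ha]
    · simp [hT.1 x hx]
  · rw [hin r hbr.symm]; exact hT.2.2.1
  · intro v hv hvr
    by_cases hvb : v = b
    · subst hvb
      have : T.arcs.filter (fun x => x.2 = v) = ∅ :=
        Finset.filter_eq_empty_iff.mpr fun x hx h => hb (h ▸ (hT.1 x hx).2)
      simp [inDeg, Finset.filter_insert, this]
    · rw [hin v hvb]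
      exact hT.2.2.2.1 v ((Finset.mem_insert.mp hv).resolve_left hvb) hvr
  · have key : ∀ v ∈ T.verts,
        Dgraph.Reaches ⟨insert b T.verts, insert (a, b) T.arcs⟩ r v := fun v hv =>
      ReflTransGen.mono (fun _ _ h => Finset.mem_insert_of_mem h) _ _ (hT.2.2.2.2 v hv)
    intro v hv
    rcases Finset.mem_insert.mp hv with rfl | hv
    · exact (key a ha).tail (Finset.mem_insert_self _ _)
    · exact key v hv

theorem card_leaves_insert_arc (hT : IsOutTree T r) {a b : V} (ha : a ∈ T.verts)
    (hb : b ∉ T.verts) :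
    (leaves T).card ≤ (leaves ⟨insert b T.verts, insert (a, b) T.arcs⟩).card := by
  have hab : a ≠ b := fun h => hb (h ▸ ha)
  have hsub : insert b ((leaves T).erase a) ⊆
      leaves ⟨insert b T.verts, insert (a, b) T.arcs⟩ := by
    intro v hv
    rcases Finset.mem_insert.mp hv with rfl | hv
    · have : T.arcs.filter (fun x => x.1 = v) = ∅ :=
        Finset.filter_eq_empty_iff.mpr fun x hx h => hb (h ▸ (hT.1 x hx).1)
      simp [leaves, outDeg, Finset.filter_insert, this, hab]
    · obtain ⟨hva, hv⟩ := Finset.mem_erase.mp hv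
      obtain ⟨hv, h0⟩ := Finset.mem_filter.mp hv
      refine Finset.mem_filter.mpr ⟨Finset.mem_insert_of_mem hv, ?_⟩
      rw [← h0]
      simp [outDeg, Finset.filter_insert, hva.symm]
  refine le_trans ?_ (Finset.card_le_card hsub)
  have hbl : b ∉ (leaves T).erase a := fun h =>
    hb (Finset.mem_filter.mp (Finset.mem_of_mem_erase h)).1
  rw [Finset.card_insert_of_notMem hbl]
  have := Finset.pred_card_le_card_erase (s := leaves T) (a := a)
  omega

end IsOutTree

theorem isOutTree_singleton (r : V) : IsOutTree ⟨{r}, ∅⟩ r := by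
  refine ⟨by simp, by simp, by simp [inDeg], ?_, ?_⟩
  · intro v hv hvr
    exact absurd (Finset.mem_singleton.mp hv) hvr
  · intro v hv
    rw [Finset.mem_singleton.mp hv]
    exact .refl

theorem exists_maximal_subgraph (P : Dgraph V → Prop) (hP : ∀ T, P T → T.verts ⊆ D.verts)
    (hne : ∃ T, P T) :
    ∃ T, P T ∧ ∀ T', P T' → T'.verts.card ≤ T.verts.card := by
  classical
  obtain ⟨T₀, h₀⟩ := hne
  let Q : ℕ → Prop := fun n => ∃ T, P T ∧ T.verts.card = n
  have hQ : Q (Nat.findGreatest Q D.verts.card) :=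
    Nat.findGreatest_spec (Finset.card_le_card (hP T₀ h₀)) ⟨T₀, h₀, rfl⟩
  obtain ⟨T, hT, hTc⟩ := hQ
  exact ⟨T, hT, fun T' hT' => hTc ▸
    Nat.le_findGreatest (Finset.card_le_card (hP T' hT')) ⟨T', hT', rfl⟩⟩

/-- An out-tree extends to an out-branching without losing leaves. -/
theorem exists_outBranching_of_outTree (hwf : DgraphWF D)
    (hreach : ∀ x ∈ D.verts, D.Reaches r x) (hTD : IsSubgraph T D) (hT : IsOutTree T r) :
    ∃ T', IsOutBranching D T' r ∧ (leaves T).card ≤ (leaves T').card := by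
  obtain ⟨T', ⟨hT'D, hT', hle⟩, hmax⟩ := exists_maximal_subgraph (D := D)
    (fun T' => IsSubgraph T' D ∧ IsOutTree T' r ∧ (leaves T).card ≤ (leaves T').card)
    (fun T' h => h.1.1) ⟨T, hTD, hT, le_rfl⟩
  refine ⟨T', ⟨hT'D, hT'D.1.antisymm fun x hx => ?_, hT'⟩, hle⟩
  have h := hreach x hx
  induction h with
  | refl => exact hT'.2.1
  | @tail a b _ hab ih =>
    have ha := ih (hwf _ hab).1
    by_contra hb
    have := hmax _ ⟨⟨Finset.insert_subset hx hT'D.1, Finset.insert_subset hab hT'D.2⟩,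
      hT'.insert_arc ha hb, hle.trans (hT'.card_leaves_insert_arc ha hb)⟩
    simp [Finset.card_insert_of_notMem hb] at this

/-- If every vertex of `W` has an in-neighbour that is reachable from `r` without using `W`, then
some out-branching has at least as many leaves as `W` has vertices. -/
theorem exists_outBranching_card_le_leaves (hwf : DgraphWF D) (hr : r ∈ D.verts)
    (hreach : ∀ x ∈ D.verts, D.Reaches r x) (W : Finset V) (hrW : r ∉ W)
    (hW : ∀ w ∈ W, ∃ u, (u, w) ∈ D.arcs ∧
      AvoidReach (fun a b => (a, b) ∈ D.arcs) (W : Set V) r u) :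
    ∃ T', IsOutBranching D T' r ∧ W.card ≤ (leaves T').card := by
  obtain ⟨T, ⟨hTD, hT, hTW⟩, hmax⟩ := exists_maximal_subgraph (D := D)
    (fun T => IsSubgraph T D ∧ IsOutTree T r ∧ ∀ a ∈ T.arcs, a.1 ∉ W)
    (fun T h => h.1.1) ⟨⟨{r}, ∅⟩, ⟨by simpa using hr, by simp⟩, isOutTree_singleton r, by simp⟩
  have hstep : ∀ a b, a ∈ T.verts → a ∉ W → (a, b) ∈ D.arcs → b ∈ T.verts := by
    intro a b ha haW hab
    by_contra hb
    have := hmax _ ⟨⟨Finset.insert_subset (hwf _ hab).2 hTD.1, Finset.insert_subset hab hTD.2⟩,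
      hT.insert_arc ha hb, by
        intro x hx
        rcases Finset.mem_insert.mp hx with rfl | hx
        · exact haW
        · exact hTW x hx⟩
    simp [Finset.card_insert_of_notMem hb] at this
  have hav : ∀ y, AvoidReach (fun a b => (a, b) ∈ D.arcs) (W : Set V) r y →
      y ∈ T.verts ∧ y ∉ W := by
    intro y hy
    induction hy with
    | refl => exact ⟨hT.2.1, hrW⟩
    | tail _ hab ih => exact ⟨hstep _ _ ih.1 ih.2 hab.1, by simpa using hab.2⟩
  obtain ⟨T', hT', hle⟩ := exists_outBranching_of_outTree hwf hreach hTD hT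
  refine ⟨T', hT', (Finset.card_le_card fun w hw => ?_).trans hle⟩
  obtain ⟨u, huw, hu⟩ := hW w hw
  refine Finset.mem_filter.mpr ⟨hstep u w (hav u hu).1 (hav u hu).2 huw, ?_⟩
  exact Finset.card_eq_zero.mpr (Finset.filter_eq_empty_iff.mpr fun a ha h => hTW a ha (h ▸ hw))

/-- If an out-branching rooted at `r` contains the arc `(u, v)`, then `u` can be reached from `r`
without meeting `v`. -/
theorem IsOutBranching.avoidReach_tail (hT : IsOutBranching D T r) {u v : V}
    (huv : (u, v) ∈ T.arcs) :
    v ≠ r ∧ AvoidReach (fun a b => (a, b) ∈ D.arcs) {v} r u := by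
  obtain ⟨hTD, -, hT⟩ := hT
  have hvr : v ≠ r := fun h => hT.not_arc_root u (h ▸ huv)
  refine ⟨hvr, IsOutTree.avoidReach hTD (hT.2.2.2.2 u (hT.1 _ huv).1) ?_ (by simpa using hvr.symm)⟩
  rintro x rfl - hx
  exact absurd (TransGen.tail' hx huv) (hT.not_transGen (hT.1 _ huv).2)

/-- In a 1-optimal out-branching, an arc which enters the set of proper descendants of a vertex `v`
and starts outside the descendants of `v` has a leaf as its tail or a successor of a branch vertex
as its head. -/
theorem OneOptimal.mem_leaves_or_mem_brSucc (hopt : OneOptimal D T r)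
    (hT : IsOutBranching D T r) {v a b : V} (hwf : DgraphWF D) (hab : (a, b) ∈ D.arcs)
    (ha : ¬ T.Reaches v a) (hb : T.Reaches v b) (hbv : b ≠ v) :
    a ∈ leaves T ∨ b ∈ brSucc T := by
  obtain ⟨hTD, hverts, hT'⟩ := id hT
  have habT : (a, b) ∉ T.arcs := fun h => ha (hT'.reaches_parent hb hbv h)
  have hbr : b ≠ r := by
    rintro rfl
    exact hbv (hT'.eq_root_of_reaches hb).symm
  obtain ⟨w, hvw, hwb⟩ := (ReflTransGen.cases_tail hb).resolve_left hbv
  have haT : a ∈ T.verts := hverts ▸ (hwf _ hab).1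
  have hwa : w ≠ a := fun h => habT (h ▸ hwb)
  by_contra hcon
  obtain ⟨haleaf, hbbr⟩ := not_or.mp hcon
  have hwdeg : outDeg T w ≤ 1 := by
    by_contra h
    exact hbbr (Finset.mem_filter.mpr ⟨(hT'.1 _ hwb).2, _, hwb, rfl, Nat.lt_of_not_le h⟩)
  have hr_reach : ∀ y, T.Reaches r y → ¬ T.Reaches b y → (oneChange T a b w).Reaches r y := by
    intro y hy
    induction hy with
    | refl => exact fun _ => .refl
    | @tail x y _ hxy ih =>
      intro hby
      refine (ih fun h => hby (h.tail hxy)).tail ?_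
      refine Finset.mem_insert_of_mem (Finset.mem_erase.mpr ⟨fun h => ?_, hxy⟩)
      obtain ⟨-, rfl⟩ := Prod.mk.inj h
      exact hby .refl
  have hb_reach : ∀ y, T.Reaches b y → (oneChange T a b w).Reaches b y := by
    intro y hy
    induction hy with
    | refl => exact .refl
    | @tail x y hbx hxy ih =>
      refine ih.tail ?_
      refine Finset.mem_insert_of_mem (Finset.mem_erase.mpr ⟨fun h => ?_, hxy⟩)
      obtain ⟨-, rfl⟩ := Prod.mk.inj h
      exact hT'.not_transGen (hT'.1 _ hxy).2 (TransGen.tail' hbx hxy)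
  have hbranch : IsOutBranching D (oneChange T a b w) r := by
    refine ⟨⟨hTD.1, Finset.insert_subset hab ((Finset.erase_subset _ _).trans hTD.2)⟩, hverts,
      ?_, hT'.2.1, ?_, ?_, ?_⟩
    · intro x hx
      rcases Finset.mem_insert.mp hx with rfl | hx
      · exact ⟨haT, (hT'.1 _ hwb).2⟩
      · exact hT'.1 x (Finset.mem_of_mem_erase hx)
    · refine Finset.card_eq_zero.mpr (Finset.filter_eq_empty_iff.mpr fun x hx hxr => ?_)
      rcases Finset.mem_insert.mp hx with rfl | hx
      · exact hbr hxr
      · exact hT'.not_arc_root x.1 (hxr ▸ Finset.mem_of_mem_erase hx)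
    · intro y hy hyr
      by_cases hyb : y = b
      · subst hyb
        refine Finset.card_eq_one.mpr ⟨(a, y), Finset.eq_singleton_iff_unique_mem.mpr
          ⟨by simp [oneChange], fun x hx => ?_⟩⟩
        obtain ⟨hx, hxy⟩ := Finset.mem_filter.mp hx
        obtain ⟨x1, x2⟩ := x
        rcases Finset.mem_insert.mp hx with h | h
        · exact h
        · obtain ⟨hne, hxT⟩ := Finset.mem_erase.mp h
          obtain rfl : x2 = y := hxy
          exact absurd (congrArg (·, x2) (hT'.parent_unique hxT hwb)) hne
      · rw [← hT'.2.2.2.1 y hy hyr]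
        unfold inDeg oneChange
        congr 1
        ext x
        obtain ⟨x1, x2⟩ := x
        simp only [Finset.mem_filter, Finset.mem_insert, Finset.mem_erase, Prod.mk.injEq]
        grind
    · intro y hy
      by_cases hby : T.Reaches b y
      · refine ((hr_reach a (hT'.2.2.2.2 a haT) fun h => ha (hb.trans h)).tail
          (Finset.mem_insert_self _ _)).trans (hb_reach y hby)
      · exact hr_reach y (hT'.2.2.2.2 y hy) hby
  have hle := hopt a b w hab habT hbr hwb r hbranch
  have hwl : w ∉ leaves T := fun h => by
    have := Finset.card_eq_zero.mp (Finset.mem_filter.mp h).2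
    have hm : (w, b) ∈ T.arcs.filter (fun x => x.1 = w) := by simp [hwb]
    simp [this] at hm
  have hsub : insert w (leaves T) ⊆ leaves (oneChange T a b w) := by
    intro x hx
    rcases Finset.mem_insert.mp hx with rfl | hx
    · refine Finset.mem_filter.mpr ⟨(hT'.1 _ hwb).1,
        Finset.card_eq_zero.mpr (Finset.filter_eq_empty_iff.mpr fun y hy hyx => ?_)⟩
      rcases Finset.mem_insert.mp hy with rfl | hy
      · exact hwa hyx.symm
      · obtain ⟨hne, hy⟩ := Finset.mem_erase.mp hy
        exact hne (Finset.card_le_one.mp hwdeg y (by simp [hy, hyx]) (x, b) (by simp [hwb]))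
    · obtain ⟨hxT, hx0⟩ := Finset.mem_filter.mp hx
      refine Finset.mem_filter.mpr ⟨hxT,
        Finset.card_eq_zero.mpr (Finset.filter_eq_empty_iff.mpr fun y hy hyx => ?_)⟩
      rcases Finset.mem_insert.mp hy with rfl | hy
      · exact haleaf ((show a = x from hyx) ▸ hx)
      · exact Finset.filter_eq_empty_iff.mp (Finset.card_eq_zero.mp hx0)
          (Finset.mem_of_mem_erase hy) hyx
  have := Finset.card_le_card hsub
  rw [Finset.card_insert_of_notMem hwl] at this
  omega

end OutTree

/-- Let `D` be a finite digraph without useless arcs for `r`, and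
let `T` be a 1-optimal out-branching of `D` rooted at `r`. If there is a leaf
`l` of `T` and a vertex `z ≺_T l` with `|HB_D^T(z,l)| ≥ 6k²`, then `D` has an
out-branching with at least `k` leaves. -/
theorem keyLemma {V : Type*} [DecidableEq V]
    (D T : Dgraph V) (r : V) (k : ℕ) (hk : 1 ≤ k) (hwf : DgraphWF D)
    (hr : r ∈ D.verts) (hreach : ∀ x ∈ D.verts, D.Reaches r x)
    (hnouseless : ∀ a ∈ D.arcs, ∃ T' : Dgraph V, IsOutBranching D T' r ∧ a ∈ T'.arcs)
    (hT : IsOutBranching D T r) (hopt : OneOptimal D T r)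
    (l z : V) (hl : l ∈ leaves T) (hzl : T.Reaches z l) (hzne : z ≠ l)
    (hcard : 6 * k ^ 2 ≤ (HBset D T z l).card) :
    ∃ (T' : Dgraph V) (r' : V), IsOutBranching D T' r' ∧ k ≤ (leaves T').card := by
  classical
  have : Nonempty V := ⟨r⟩
  by_cases hL : k ≤ (leaves T).card
  · exact ⟨T, r, hT, hL⟩
  by_contra hcon
  obtain ⟨hTD, hverts, hT'⟩ := id hT
  set E : V → V → Prop := fun a b => (a, b) ∈ D.arcs with hE
  set H := HBset D T z l with hH
  have hlT : l ∈ T.verts := (Finset.mem_filter.mp hl).1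
  obtain ⟨M, q, hq0, hqM, hq⟩ := exists_path_of_reflTransGen hzl
  have hqE : ∀ i < M, E (q i) (q (i + 1)) := fun i hi => hTD.2 (hq i hi)
  have hHmem : ∀ v ∈ H, T.Reaches v z ∧ v ≠ z ∧ v ≠ r ∧ v ∈ T.verts ∧
      ∃ i ≤ M, (q i, v) ∈ D.arcs ∧ AvoidReach E {v} r (q i) := by
    intro v hv
    obtain ⟨⟨u, v'⟩, hm, rfl⟩ := Finset.mem_image.mp (Finset.mem_sdiff.mp hv).1
    obtain ⟨huv, ⟨hvz, hne⟩, hzu, hul⟩ := Finset.mem_filter.mp hm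
    obtain ⟨T', hTb, huvT'⟩ := hnouseless _ huv
    obtain ⟨hvr, hav⟩ := hTb.avoidReach_tail huvT'
    obtain ⟨i, hi, rfl⟩ := hT'.mem_path hq (hq0.symm ▸ hzu) (hqM.symm ▸ hul)
    exact ⟨hvz, hne, hvr, hverts ▸ (hwf _ huv).2, i, hi, huv, hav⟩
  choose! hvz hvne hvr hvT e heM he hav using hHmem
  have hqH : ∀ i ≤ M, ∀ v ∈ H, q i ≠ v := by
    rintro i hi v hv rfl
    have h := reflTransGen_of_path (E := fun a b => (a, b) ∈ T.arcs) hq (Nat.zero_le i) hi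
    rw [hq0] at h
    exact hvne _ hv (hT'.reaches_antisymm (hvz _ hv) h)
  let τ : V → ℕ := fun v => sInf {j | AvoidReach E {v} r (q j)}
  have hτ : ∀ v ∈ H, AvoidReach E {v} r (q (τ v)) := fun v hv =>
    Nat.sInf_mem (s := {j | AvoidReach E {v} r (q j)}) ⟨e v, hav v hv⟩
  have hτle : ∀ v j, AvoidReach E {v} r (q j) → τ v ≤ j := fun v j h => Nat.sInf_le h
  have hτe : ∀ v ∈ H, τ v ≤ e v := fun v hv => hτle _ _ (hav v hv)
  have hpierce : ∀ x, (H.filter fun v => τ v ≤ x ∧ x ≤ e v).card ≤ 2 * k - 1 := by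
    intro x
    by_contra hbig
    set S := H.filter fun v => τ v ≤ x ∧ x ≤ e v with hS
    have hSmem : ∀ v ∈ S, v ∈ H ∧ τ v ≤ x ∧ x ≤ e v := fun v hv => Finset.mem_filter.mp hv
    obtain ⟨s₀, hs₀⟩ := Finset.card_pos.mp (show 0 < S.card by omega)
    have hxM : x ≤ M := (hSmem s₀ hs₀).2.2.trans (heM _ (hSmem s₀ hs₀).1)
    have hzx := reflTransGen_of_path (E := fun a b => (a, b) ∈ T.arcs) hq (Nat.zero_le x) hxM
    have hxT : q x ∈ T.verts := hT'.mem_verts_of_reaches hzx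
      (hq0.symm ▸ hT'.mem_verts_of_reaches (hvz _ (hSmem s₀ hs₀).1) (hvT _ (hSmem s₀ hs₀).1))
    obtain ⟨n, p, hp0, hpn, hp⟩ := exists_path_of_reflTransGen (hT'.2.2.2.2 _ hxT)
    obtain ⟨W, hWS, hWc, hW⟩ := exists_walk_avoiding_half (E := E) (n := n) (p := p) S
      (fun i hi => hTD.2 (hp i hi)) (hT'.path_injective hp) (by
        intro s hs
        have hsH := (hSmem s hs).1
        obtain ⟨i, hi, rfl⟩ := hT'.mem_path hp (hp0.symm ▸ hT'.2.2.2.2 s (hvT s hsH))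
          (hpn.symm ▸ (hvz s hsH).trans (hq0 ▸ hzx))
        refine ⟨i, Nat.pos_of_ne_zero ?_, hi.lt_of_ne ?_, rfl⟩
        · rintro rfl
          exact hvr _ hsH hp0
        · rintro rfl
          exact hqH x hxM _ hsH hpn.symm) (by
        intro s hs
        obtain ⟨hsH, hτx, -⟩ := hSmem s hs
        rw [hp0, hpn]
        exact (hτ s hsH).along_path hqE hτx hxM fun i _ hi => hqH i (hi.trans hxM) s hsH)
    rw [hp0, hpn] at hW
    obtain ⟨T', hT'b, hle⟩ := exists_outBranching_card_le_leaves hwf hr hreach W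
      (fun h => hvr r (hSmem r (hWS h)).1 rfl) (by
        intro w hw
        obtain ⟨hwH, -, hxe⟩ := hSmem w (hWS hw)
        refine ⟨q (e w), he w hwH, hW.along_path hqE hxe (heM w hwH) fun i _ hi hiW => ?_⟩
        exact hqH i (hi.trans (heM w hwH)) _ (hSmem _ (hWS hiW)).1 rfl)
    exact hcon ⟨T', r, hT'b, by omega⟩
  obtain ⟨I, hIH, hIc, hdis⟩ := exists_disjoint_intervals τ e (2 * k - 1) (3 * k) H hτe hpierce
    (le_trans (by
      calc 3 * k * (2 * k - 1) ≤ 3 * k * (2 * k) := Nat.mul_le_mul_left _ (Nat.sub_le _ _)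
        _ = 6 * k ^ 2 := by ring) hcard) (by omega)
  obtain ⟨v₀, hv₀, hmin⟩ := I.exists_min_image e (Finset.card_pos.mp (by omega))
  have hpos : ∀ v ∈ I.erase v₀, 0 < τ v := by
    intro v hv
    obtain ⟨hne, hvI⟩ := Finset.mem_erase.mp hv
    have h1 := hτe v₀ (hIH hv₀)
    have h2 := hmin v hvI
    rcases hdis v hvI v₀ hv₀ hne with h | h <;> omega
  have hentry : ∀ v ∈ H, ∃ a b, (a, b) ∈ D.arcs ∧ ¬ T.Reaches v a ∧ T.Reaches v b ∧ b ≠ v ∧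
      AvoidReach E ({x | T.Reaches v x}ᶜ ∪ {v}) b (q (τ v)) := by
    intro v hv
    have hvq : T.Reaches v (q (τ v)) := (hvz v hv).trans
      (hq0 ▸ reflTransGen_of_path (E := fun a b => (a, b) ∈ T.arcs) hq (Nat.zero_le _)
        ((hτe v hv).trans (heM v hv)))
    obtain ⟨a, b, h1, h2, h3, h4, h5⟩ := (hτ v hv).last_entry (A := {x | T.Reaches v x})
      (fun h => hvr v hv (hT'.eq_root_of_reaches h)) hvq
    exact ⟨a, b, h1, h2, h3, h4, h5⟩
  choose! a b hab ha hb hbv hbq using hentry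
  let f : V → V ⊕ V := fun v => if a v ∈ leaves T then .inl (a v) else .inr (b v)
  have hf : ∀ v ∈ I.erase v₀, f v ∈ (leaves T).disjSum (brSucc T) := by
    intro v hv
    have hvH := hIH (Finset.mem_of_mem_erase hv)
    have h := hopt.mem_leaves_or_mem_brSucc hT hwf (hab v hvH) (ha v hvH) (hb v hvH) (hbv v hvH)
    by_cases h' : a v ∈ leaves T
    · simp [f, h']
    · simp [f, h', h.resolve_left h']
  have hcontra : ∀ i ∈ I.erase v₀, ∀ j ∈ I.erase v₀, i ≠ j → f i = f j → ¬ e i < τ j := by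
    intro i hi j hj hij hfij hlt
    have hiH := hIH (Finset.mem_of_mem_erase hi)
    have hjH := hIH (Finset.mem_of_mem_erase hj)
    have hnot : ¬ AvoidReach E {j} r (q (τ i)) := fun h => by
      have := hτle _ _ h
      have := hτe i hiH
      omega
    have hnij : ¬ T.Reaches i j := by
      intro h
      have hrj := (hτ i hiH).through hnot
      have hjz : AvoidReach E {i} j z := by
        refine IsOutTree.avoidReach hTD (hvz j hjH) ?_ (by simpa using hij.symm)
        rintro x rfl hx -
        exact hT'.reaches_antisymm h hx
      have := hτle i 0 (hq0.symm ▸ hrj.trans hjz)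
      have := hpos i hi
      omega
    obtain ⟨a', ha'b, ha'j⟩ : ∃ a', (a', b i) ∈ D.arcs ∧ ¬ T.Reaches j a' := by
      by_cases h1 : a i ∈ leaves T <;> by_cases h2 : a j ∈ leaves T <;> simp [f, h1, h2] at hfij
      · exact ⟨a i, hab i hiH, hfij ▸ ha j hjH⟩
      · exact ⟨a j, hfij ▸ hab j hjH, ha j hjH⟩
    have hra' : AvoidReach E {j} r a' := by
      refine IsOutTree.avoidReach hTD (hT'.2.2.2.2 a' (hverts ▸ (hwf _ ha'b).1)) ?_
        (by simpa using (hvr j hjH).symm)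
      rintro x rfl - hx
      exact absurd hx ha'j
    refine hnot ((hra'.tail ha'b fun h => hnij ?_).trans ((hbq i hiH).anti ?_))
    · exact (show b i = j from h) ▸ hb i hiH
    · rintro x rfl
      exact .inl hnij
  have hbound := hT'.card_brSucc_add_two_le
  obtain ⟨i, hi, j, hj, hij, hfij⟩ := Finset.exists_ne_map_eq_of_card_lt_of_maps_to
    (s := I.erase v₀) (t := (leaves T).disjSum (brSucc T)) (f := f) (by
      rw [Finset.card_disjSum, Finset.card_erase_of_mem hv₀]; omega) hf
  rcases hdis i (Finset.mem_of_mem_erase hi) j (Finset.mem_of_mem_erase hj) hij with h | h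
  · exact hcontra i hi j hj hij hfij h
  · exact hcontra j hj i hi hij.symm hfij.symm h
end

section
/- Let T be an out-branching of a finite digraph D, let (u,v) ∈ A(D)∖A(T) with v not the root of T, and let T′ = T + (u,v) − (w,v) be the result of the 1-change for (u,v), where w is the unique in-neighbor of v in T. If the underlying undirected graph of T′ contains a cycle C, then C is in fact a directed cycle of T′ that contains the arc (u,v), and consequently v ⪯_T u. -/
variable {V : Type*} [DecidableEq V]

theorem mem_cycPairs_iff {V : Type*} (l : List V) (p : V × V) :
    p ∈ cycPairs l ↔ ∃ (i : ℕ) (h : i < l.length),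
      p = (l[i], l[(i + 1) % l.length]'(Nat.mod_lt _ (by omega))) := by
  unfold cycPairs
  constructor
  · intro hp
    obtain ⟨i, hi, rfl⟩ := List.mem_iff_getElem.1 hp
    have hi' : i < l.length := by simp at hi; omega
    exact ⟨i, hi', by simp [List.getElem_rotate]⟩
  · rintro ⟨i, hi, rfl⟩
    exact List.mem_iff_getElem.2 ⟨i, by simpa using hi, by simp [List.getElem_rotate]⟩

theorem swap_mem_cycPairs_of_mem_reverse {V : Type*} {l : List V} {p : V × V}
    (hp : p ∈ cycPairs l.reverse) : p.swap ∈ cycPairs l := by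
  obtain ⟨i, hi, rfl⟩ := (mem_cycPairs_iff _ _).1 hp
  rw [List.length_reverse] at hi
  refine (mem_cycPairs_iff _ _).2 ⟨l.length - 1 - (i + 1) % l.length, by omega, ?_⟩
  simp only [List.getElem_reverse, Prod.swap_prod_mk, List.length_reverse, Prod.mk.injEq, true_and]
  congr 1
  rcases Nat.lt_or_ge (i + 1) l.length with h | h
  · rw [Nat.mod_eq_of_lt h, Nat.mod_eq_of_lt (by omega)]
    omega
  · obtain rfl : i = l.length - 1 := by omega
    rw [Nat.sub_add_cancel (by omega), Nat.mod_self, Nat.sub_zero, Nat.sub_add_cancel (by omega),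
      Nat.mod_self]
    omega

/-- A nonempty list without repetitions is traversed cyclically by a periodic sequence. -/
theorem exists_periodic_enumeration {V : Type*} {l : List V} (hnd : l.Nodup) (hc : 0 < l.length) :
    ∃ f : ℕ → V, (∀ p, p ∈ cycPairs l ↔ ∃ i, p = (f i, f (i + 1))) ∧
      ∀ i j, f i = f j ↔ i % l.length = j % l.length := by
  refine ⟨fun i => l[i % l.length]'(Nat.mod_lt _ hc), fun p => ?_, fun i j => ?_⟩
  · rw [mem_cycPairs_iff]
    constructor
    · rintro ⟨i, hi, rfl⟩
      exact ⟨i, by simp [Nat.mod_eq_of_lt hi]⟩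
    · rintro ⟨i, rfl⟩
      exact ⟨i % l.length, Nat.mod_lt _ hc, by simp⟩
  · exact hnd.getElem_inj_iff

/-- In a digraph with in-degrees at most one, every undirected cycle is directed. -/
theorem directed_of_inNeighbor_unique {V : Type*} {A : Finset (V × V)}
    (huniq : ∀ a b x, (a, x) ∈ A → (b, x) ∈ A → a = b)
    {c : List V} (hnd : c.Nodup) (hlen : 3 ≤ c.length)
    (hcyc : ∀ p ∈ cycPairs c, p ∈ A ∨ p.swap ∈ A) :
    (∀ p ∈ cycPairs c, p ∈ A) ∨ ∀ p ∈ cycPairs c.reverse, p ∈ A := by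
  obtain ⟨f, hf, hinj⟩ := exists_periodic_enumeration hnd (by omega)
  by_cases hfwd : ∃ i, (f i, f (i + 1)) ∈ A
  · left
    obtain ⟨i, hi⟩ := hfwd
    have step : ∀ k, (f (i + k), f (i + k + 1)) ∈ A := by
      intro k
      induction k with
      | zero => exact hi
      | succ k ih =>
        refine (hcyc _ ((hf _).2 ⟨i + (k + 1), rfl⟩)).resolve_right fun hback => ?_
        have heq := (hinj _ _).1 (huniq _ _ _ ih hback)
        have hmod : i + k + 0 ≡ i + k + 2 [MOD c.length] := heq
        have := Nat.ModEq.add_left_cancel' _ hmod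
        rw [Nat.ModEq, Nat.zero_mod, Nat.mod_eq_of_lt (by omega)] at this
        omega
    intro p hp
    obtain ⟨j, rfl⟩ := (hf p).1 hp
    have hle : i ≤ j + i * c.length :=
      (Nat.le_mul_of_pos_right i (by omega)).trans (Nat.le_add_left _ _)
    have hs := step (j + i * c.length - i)
    rw [Nat.add_sub_cancel' hle] at hs
    rwa [(hinj (j + i * c.length) j).2 (by simp),
      (hinj (j + i * c.length + 1) (j + 1)).2 (by rw [Nat.add_right_comm]; simp)] at hs
  · right
    intro p hp
    have hs := swap_mem_cycPairs_of_mem_reverse hp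
    refine (hcyc _ hs).resolve_left fun h => hfwd ?_
    obtain ⟨i, hi⟩ := (hf _).1 hs
    exact ⟨i, hi ▸ h⟩

theorem IsOutTree.inNeighbor_unique {V : Type*} [DecidableEq V] {T : Dgraph V} {r : V}
    (hT : IsOutTree T r) {a b x : V} (ha : (a, x) ∈ T.arcs) (hb : (b, x) ∈ T.arcs) : a = b := by
  have hle : inDeg T x ≤ 1 := by
    by_cases hx : x = r
    · rw [hx, hT.2.2.1]
      exact Nat.zero_le _
    · exact (hT.2.2.2.1 x (hT.1 _ ha).2 hx).le
  exact congrArg Prod.fst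
    (Finset.card_le_one.1 hle (a, x) (by simp [ha]) (b, x) (by simp [hb]))

theorem IsOutTree.not_arc_to_root {V : Type*} [DecidableEq V] {T : Dgraph V} {r : V}
    (hT : IsOutTree T r) (a : V) : (a, r) ∉ T.arcs := fun ha =>
  Finset.notMem_empty (a, r) (Finset.card_eq_zero.1 hT.2.2.1 ▸ Finset.mem_filter.2 ⟨ha, rfl⟩)

/-- An out-tree has no infinite backward walk. -/
theorem IsOutTree.false_of_forall_exists_inNeighbor {V : Type*} [DecidableEq V] {T : Dgraph V}
    {r : V} (hT : IsOutTree T r) {S : Set V} (hne : S.Nonempty)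
    (hS : ∀ x ∈ S, ∃ y ∈ S, (y, x) ∈ T.arcs) : False := by
  obtain ⟨x, hx⟩ := hne
  obtain ⟨y, -, hyx⟩ := hS x hx
  have hroot : r ∈ S := by
    refine Relation.ReflTransGen.head_induction_on (motive := fun a _ => a ∈ S)
      (hT.2.2.2.2 x (hT.1 _ hyx).2) hx fun {a b} hab _ hb => ?_
    obtain ⟨z, hz, hzb⟩ := hS b hb
    rwa [hT.inNeighbor_unique hab hzb]
  obtain ⟨z, -, hz⟩ := hS r hroot
  exact hT.not_arc_to_root z hz

theorem mem_arcs_of_mem_oneChange {V : Type*} [DecidableEq V] {T : Dgraph V} {u v w : V}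
    {p : V × V} (hp : p ∈ (oneChange T u v w).arcs) (hne : p ≠ (u, v)) : p ∈ T.arcs :=
  Finset.mem_of_mem_erase ((Finset.mem_insert.1 hp).resolve_left hne)

theorem IsOutTree.oneChange_inNeighbor_unique {V : Type*} [DecidableEq V] {T : Dgraph V}
    {r u v w : V} (hT : IsOutTree T r) (hw : (w, v) ∈ T.arcs) (a b x : V)
    (ha : (a, x) ∈ (oneChange T u v w).arcs) (hb : (b, x) ∈ (oneChange T u v w).arcs) :
    a = b := by
  simp only [oneChange, Finset.mem_insert, Finset.mem_erase, Prod.mk.injEq, ne_eq] at ha hb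
  rcases ha with ⟨rfl, rfl⟩ | ⟨hna, ha⟩ <;> rcases hb with ⟨rfl, hb'⟩ | ⟨hnb, hb⟩
  · rfl
  · exact (hnb ⟨hT.inNeighbor_unique hb hw, rfl⟩).elim
  · subst hb'
    exact (hna ⟨hT.inNeighbor_unique ha hw, rfl⟩).elim
  · exact hT.inNeighbor_unique ha hb

/-- A directed cycle of `T + (u,v) - (w,v)` uses the arc `(u,v)` and closes a dipath of `T`
from `v` to `u`. -/
theorem IsOutTree.mem_cycPairs_and_reaches {V : Type*} [DecidableEq V] {T : Dgraph V}
    {r u v w : V} (hT : IsOutTree T r) {c : List V} (hnd : c.Nodup) (hc : 0 < c.length)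
    (hdir : ∀ p ∈ cycPairs c, p ∈ (oneChange T u v w).arcs) :
    (u, v) ∈ cycPairs c ∧ T.Reaches v u := by
  obtain ⟨f, hf, hinj⟩ := exists_periodic_enumeration hnd hc
  have hmem : (u, v) ∈ cycPairs c := by
    by_contra hnot
    refine hT.false_of_forall_exists_inNeighbor (S := Set.range f) ⟨f 0, 0, rfl⟩ ?_
    rintro _ ⟨i, rfl⟩
    have hp : (f (i + c.length - 1), f i) ∈ cycPairs c := by
      refine (hf _).2 ⟨i + c.length - 1, ?_⟩
      rw [Nat.sub_add_cancel (by omega), (hinj (i + c.length) i).2 (by simp)]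
    exact ⟨_, ⟨_, rfl⟩, mem_arcs_of_mem_oneChange (hdir _ hp) fun h => hnot (h ▸ hp)⟩
  refine ⟨hmem, ?_⟩
  obtain ⟨i, hi⟩ := (hf _).1 hmem
  obtain ⟨rfl, rfl⟩ := Prod.mk.inj hi
  have hreach : ∀ k < c.length, T.Reaches (f (i + 1)) (f (i + 1 + k)) := by
    intro k
    induction k with
    | zero => exact fun _ => Relation.ReflTransGen.refl
    | succ k ih =>
      intro hk
      refine (ih (by omega)).tail
        (mem_arcs_of_mem_oneChange (hdir _ ((hf _).2 ⟨i + 1 + k, rfl⟩)) fun h => ?_)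
      have hmod : i + (1 + k) ≡ i + 0 [MOD c.length] := by
        rw [← Nat.add_assoc]
        exact (hinj _ _).1 (Prod.mk.inj h).1
      have := Nat.ModEq.add_left_cancel' _ hmod
      rw [Nat.ModEq, Nat.mod_eq_of_lt (by omega), Nat.zero_mod] at this
      omega
  have hlast := hreach (c.length - 1) (by omega)
  rwa [(hinj (i + 1 + (c.length - 1)) i).2
    (by rw [Nat.add_assoc, Nat.add_sub_cancel' hc]; simp)] at hlast

/-- Let `T` be an out-branching of `D`, `(u,v) ∈ A(D) \ A(T)`
with `v` not the root, and `T' = T + (u,v) − (w,v)` the result of the 1-change.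
If the underlying undirected graph of `T'` contains a cycle `C` (a cyclic
sequence of at least 3 distinct vertices, consecutive ones joined by an arc of
`T'` in one direction or the other), then `C` is in fact a directed cycle of
`T'` (in one of its two traversal directions) containing the arc `(u,v)`, and
consequently `v ⪯_T u`. -/
theorem cycle_in_oneChange_is_directed {V : Type*} [DecidableEq V]
    (D T : Dgraph V) (r u v w : V) (hwf : DgraphWF D)
    (hT : IsOutBranching D T r) (haD : (u, v) ∈ D.arcs) (haT : (u, v) ∉ T.arcs)
    (hvr : v ≠ r) (hw : (w, v) ∈ T.arcs)
    (c : List V) (hnd : c.Nodup) (hlen : 3 ≤ c.length)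
    (hcyc : ∀ p ∈ cycPairs c,
      p ∈ (oneChange T u v w).arcs ∨ p.swap ∈ (oneChange T u v w).arcs) :
    (((∀ p ∈ cycPairs c, p ∈ (oneChange T u v w).arcs) ∧ (u, v) ∈ cycPairs c) ∨
     ((∀ p ∈ cycPairs c.reverse, p ∈ (oneChange T u v w).arcs) ∧
       (u, v) ∈ cycPairs c.reverse)) ∧
    T.Reaches v u := by
  have hTree := hT.2.2
  rcases directed_of_inNeighbor_unique (hTree.oneChange_inNeighbor_unique hw) hnd hlen hcyc
    with h | h
  · have := hTree.mem_cycPairs_and_reaches hnd (by omega) h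
    exact ⟨Or.inl ⟨h, this.1⟩, this.2⟩
  · have := hTree.mem_cycPairs_and_reaches (List.nodup_reverse.2 hnd) (by simp; omega) h
    exact ⟨Or.inr ⟨h, this.1⟩, this.2⟩
end
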